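/- arXiv:1708.09559 — 3 statements merged into one kernel-verified Lean document; each statement's English description precedes it below -/
import Mathlib

section
/- Let R be a commutative ring and let A and B be n×n matrices over R with n ≥ 2. Then the coefficient of x·y in the polynomial det(I_n + x·A + y·B) ∈ R[x,y] equals trace(A)·trace(B) − trace(A·B). -/
/-- Second-order expansion of `det (1 + r A + s B)` along square-zero parameters `r` and `s`. -/
theorem det_one_add_smul_add_smul_of_sq_eq_zero {S ι : Type*} [CommRing S] [Fintype ι]
    [DecidableEq ι] (A B : Matrix ι ι S) {r s : S} (hr : r ^ 2 = 0) (hs : s ^ 2 = 0) :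
    (1 + r • A + s • B).det =
      1 + r * A.trace + s * B.trace + r * s * (A.trace * B.trace - (A * B).trace) := by
  have factorization : 1 + r • A + s • B = (1 + r • A) * (1 + s • (B - r • (A * B))) := by
    have h : r * s * r = 0 := by linear_combination s * hr
    simp only [mul_add, add_mul, mul_sub, smul_sub, mul_one, one_mul, Matrix.smul_mul,
      Matrix.mul_smul, smul_smul, mul_comm s r, h, zero_smul]
    abel
  rw [factorization, Matrix.det_mul, Matrix.det_one_add_smul r, Matrix.det_one_add_smul s, hr, hs,
    Matrix.trace_sub, Matrix.trace_smul, smul_eq_mul]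
  linear_combination -s * A.trace * (A * B).trace * hr

/-- Modulo `r ^ 2` and `s ^ 2`, the determinant of `1 + r A + s B` is its second-order expansion. -/
theorem det_one_add_smul_add_smul_sub_mem_span {S ι : Type*} [CommRing S] [Fintype ι]
    [DecidableEq ι] (A B : Matrix ι ι S) (r s : S) :
    (1 + r • A + s • B).det -
      (1 + r * A.trace + s * B.trace + r * s * (A.trace * B.trace - (A * B).trace)) ∈
      Ideal.span {r ^ 2, s ^ 2} := by
  rw [← Ideal.Quotient.eq]
  set q := Ideal.Quotient.mk (Ideal.span {r ^ 2, s ^ 2})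
  have hr : q r ^ 2 = 0 := by
    rw [← map_pow]
    exact Ideal.Quotient.eq_zero_iff_mem.2 (Ideal.subset_span (by simp))
  have hs : q s ^ 2 = 0 := by
    rw [← map_pow]
    exact Ideal.Quotient.eq_zero_iff_mem.2 (Ideal.subset_span (by simp))
  have h := det_one_add_smul_add_smul_of_sq_eq_zero (A.map q) (B.map q) hr hs
  have map_matrix : q.mapMatrix (1 + r • A + s • B) = 1 + q r • A.map q + q s • B.map q := by
    rw [map_add, map_add, map_one]
    congr 2
  rw [RingHom.map_det, map_matrix, h, ← Matrix.map_mul]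
  simp only [map_add, map_mul, map_sub, map_one, AddMonoidHom.map_trace]

/-- For `n ≥ 2` and `n×n` matrices `A, B` over a commutative ring, the
coefficient of `x·y` in `det(I_n + x·A + y·B)` is
`trace(A)·trace(B) − trace(A·B)`. -/
theorem stmt_6 (R : Type*) [CommRing R] (n : ℕ) (hn : 2 ≤ n)
    (A B : Matrix (Fin n) (Fin n) R) :
    MvPolynomial.coeff (Finsupp.single (0 : Fin 2) 1 + Finsupp.single 1 1)
      (Matrix.det
        (1 + (MvPolynomial.X 0 : MvPolynomial (Fin 2) R) • A.map MvPolynomial.C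
           + (MvPolynomial.X 1 : MvPolynomial (Fin 2) R) • B.map MvPolynomial.C))
      = A.trace * B.trace - (A * B).trace := by
  obtain ⟨u, v, huv⟩ := Ideal.mem_span_pair.1
    (det_one_add_smul_add_smul_sub_mem_span (A.map MvPolynomial.C) (B.map MvPolynomial.C)
      (MvPolynomial.X 0 : MvPolynomial (Fin 2) R) (MvPolynomial.X 1))
  have trace_map (M : Matrix (Fin n) (Fin n) R) :
      (M.map (MvPolynomial.C (σ := Fin 2))).trace = MvPolynomial.C M.trace :=
    (AddMonoidHom.map_trace (MvPolynomial.C (σ := Fin 2)) M).symm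
  rw [← Matrix.map_mul, trace_map, trace_map, trace_map] at huv
  have expansion := sub_eq_iff_eq_add.1 huv.symm
  have hX (i : Fin 2) (k : ℕ) :
      (MvPolynomial.X i : MvPolynomial (Fin 2) R) ^ k =
        MvPolynomial.monomial (Finsupp.single i k) 1 := MvPolynomial.X_pow_eq_monomial
  have hXY : (MvPolynomial.X 0 * MvPolynomial.X 1 : MvPolynomial (Fin 2) R) =
      MvPolynomial.monomial (Finsupp.single 0 1 + Finsupp.single 1 1) 1 := by
    simp [MvPolynomial.X, MvPolynomial.monomial_mul]
  rw [expansion, ← map_mul, ← map_sub, hX, hX, hXY,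
    mul_comm _ (MvPolynomial.C A.trace), mul_comm _ (MvPolynomial.C B.trace),
    mul_comm _ (MvPolynomial.C (A.trace * B.trace - (A * B).trace))]
  simp [MvPolynomial.coeff_mul_monomial', MvPolynomial.coeff_X, MvPolynomial.coeff_one,
    Finsupp.le_def, Finsupp.ext_iff, Fin.forall_fin_two]
end

section
/- Let Q be a doubly stochastic d×d matrix and let u, w ∈ ℝ^d be vectors whose entries are both arranged in decreasing order (u₁ ≥ u₂ ≥ ⋯ ≥ u_d and w₁ ≥ w₂ ≥ ⋯ ≥ w_d). Then ∑_{i=1}^d u_i w_{d+1−i} ≤ ∑_{i,j} u_i Q_{ij} w_j ≤ ∑_{i=1}^d u_i w_i. That is, over doubly stochastic Q the bilinear form uᵀQw attains its maximum at the identity permutation matrix (both vectors similarly ordered) and its minimum at the order-reversing permutation matrix (vectors oppositely ordered). -/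
open Matrix Finset

/-- The bilinear form of a doubly stochastic matrix is a convex combination of the bilinear forms
of the permutation matrices. -/
theorem exists_sum_perm_eq_bilinear_of_mem_doublyStochastic {n : Type*} [Fintype n] [DecidableEq n]
    {Q : Matrix n n ℝ} (hQ : Q ∈ doublyStochastic ℝ n) (u w : n → ℝ) :
    ∃ c : Equiv.Perm n → ℝ, (∀ σ, 0 ≤ c σ) ∧ ∑ σ, c σ = 1 ∧
      ∑ i, ∑ j, u i * Q i j * w j = ∑ σ, c σ * ∑ i, u i * w (σ i) := by
  obtain ⟨c, hc0, hc1, rfl⟩ := exists_eq_sum_perm_of_mem_doublyStochastic hQ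
  refine ⟨c, hc0, hc1, ?_⟩
  have h_perm (σ : Equiv.Perm n) (i : n) : ∑ j, σ.permMatrix ℝ i j * w j = w (σ i) := by
    simp [Equiv.Perm.permMatrix, PEquiv.toMatrix_apply]
  simp_rw [← h_perm, Matrix.sum_apply, Matrix.smul_apply, smul_eq_mul, mul_sum, sum_mul]
  calc
    _ = ∑ i, ∑ σ, ∑ j, u i * (c σ * σ.permMatrix ℝ i j) * w j :=
      sum_congr rfl fun _ _ ↦ sum_comm
    _ = ∑ σ, ∑ i, ∑ j, u i * (c σ * σ.permMatrix ℝ i j) * w j := sum_comm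
    _ = _ := by
      refine sum_congr rfl fun _ _ ↦ sum_congr rfl fun _ _ ↦ sum_congr rfl fun _ _ ↦ ?_
      ring

/-- Rearrangement-type bounds: for a doubly stochastic `Q` and decreasingly
ordered vectors `u, w`, one has
`∑ᵢ uᵢ w_{d+1-i} ≤ uᵀQw ≤ ∑ᵢ uᵢ wᵢ`. -/
theorem stmt_14 (d : ℕ) (Q : Matrix (Fin d) (Fin d) ℝ)
    (hQ0 : ∀ i j, 0 ≤ Q i j) (hQrow : ∀ i, ∑ j, Q i j = 1)
    (hQcol : ∀ j, ∑ i, Q i j = 1)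
    (u w : Fin d → ℝ) (hu : Antitone u) (hw : Antitone w) :
    (∑ i, u i * w i.rev) ≤ (∑ i, ∑ j, u i * Q i j * w j) ∧
    (∑ i, ∑ j, u i * Q i j * w j) ≤ ∑ i, u i * w i := by
  have hQ : Q ∈ doublyStochastic ℝ (Fin d) :=
    mem_doublyStochastic_iff_sum.2 ⟨hQ0, hQrow, hQcol⟩
  obtain ⟨c, hc0, hc1, hc⟩ := exists_sum_perm_eq_bilinear_of_mem_doublyStochastic hQ u w
  have h_lower (σ : Equiv.Perm (Fin d)) : ∑ i, u i * w i.rev ≤ ∑ i, u i * w (σ i) := by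
    have h_anti : Antivary u fun i ↦ w i.rev :=
      hu.antivary fun _ _ h ↦ hw (Fin.rev_le_rev.2 h)
    simpa using h_anti.sum_mul_le_sum_mul_comp_perm (σ := σ.trans Fin.revPerm)
  have h_upper (σ : Equiv.Perm (Fin d)) : ∑ i, u i * w (σ i) ≤ ∑ i, u i * w i :=
    (hu.monovary hw).sum_mul_comp_perm_le_sum_mul
  rw [hc]
  constructor
  · calc
      _ = ∑ σ, c σ * ∑ i, u i * w i.rev := by rw [← sum_mul, hc1, one_mul]
      _ ≤ _ := sum_le_sum fun σ _ ↦ mul_le_mul_of_nonneg_left (h_lower σ) (hc0 σ)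
  · calc
      _ ≤ ∑ σ, c σ * ∑ i, u i * w i :=
        sum_le_sum fun σ _ ↦ mul_le_mul_of_nonneg_left (h_upper σ) (hc0 σ)
      _ = _ := by rw [← sum_mul, hc1, one_mul]
end

section
/- Let σ be a permutation of {1,…,d}, let τ be a transposition (the swap of two distinct indices a ≠ b), and let α ∈ [0,1]. Then the doubly stochastic matrix α·P_σ + (1−α)·P_{σ∘τ} is orthostochastic: there exists a real orthogonal d×d matrix V such that V_{ij}² = α·(P_σ)_{ij} + (1−α)·(P_{σ∘τ})_{ij} for all i, j. -/
open Matrix Finset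

/-- The rotation with cosine `c` and sine `s` in the plane of the coordinates `a` and `b`. -/
def givensRotation {n : Type*} [DecidableEq n] (a b : n) (c s : ℝ) : Matrix n n ℝ :=
  fun i j => (if j = a ∨ j = b then c else 1) * (if i = j then 1 else 0) +
    (if j = a then s else if j = b then -s else 0) * (if i = Equiv.swap a b j then 1 else 0)

theorem sum_mul_ite_add_mul_ite {n : Type*} [Fintype n] [DecidableEq n] (x y z w : n)
    (p q r t : ℝ) :
    ∑ i, (p * (if i = x then 1 else 0) + q * (if i = y then 1 else 0)) *
        (r * (if i = z then 1 else 0) + t * (if i = w then 1 else 0)) =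
      p * r * (if x = z then 1 else 0) + p * t * (if x = w then 1 else 0) +
        q * r * (if y = z then 1 else 0) + q * t * (if y = w then 1 else 0) := by
  simp only [mul_ite, mul_one, mul_zero, add_mul, ite_mul, zero_mul, Finset.sum_add_distrib,
    Finset.sum_ite_eq', Finset.mem_univ, if_true]
  split_ifs <;> ring

theorem givensRotation_transpose_mul_self {n : Type*} [Fintype n] [DecidableEq n] {a b : n}
    (hab : a ≠ b) {c s : ℝ} (hcs : c ^ 2 + s ^ 2 = 1) :
    (givensRotation a b c s)ᵀ * givensRotation a b c s = 1 := by
  ext j k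
  simp only [Matrix.mul_apply, Matrix.transpose_apply, givensRotation, Matrix.one_apply]
  rw [sum_mul_ite_add_mul_ite]
  simp only [Equiv.swap_apply_def]
  grind

theorem givensRotation_sq {n : Type*} [DecidableEq n] {a b : n} (hab : a ≠ b) (c s : ℝ)
    (hcs : c ^ 2 + s ^ 2 = 1) (i j : n) :
    givensRotation a b c s i j ^ 2 = c ^ 2 * (if i = j then 1 else 0) +
      s ^ 2 * (if i = Equiv.swap a b j then 1 else 0) := by
  simp only [givensRotation, Equiv.swap_apply_def]
  grind

/-- Any convex combination of a permutation matrix `P_σ` and `P_{σ∘τ}`, where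
`τ` is a transposition, is orthostochastic: there is an orthogonal matrix `V`
with `V_{ij}² = α·(P_σ)_{ij} + (1-α)·(P_{σ∘τ})_{ij}`.  Here `P_σ` has `(i,j)`
entry `1` iff `i = σ(j)`. -/
theorem stmt_15 (d : ℕ) (σ : Equiv.Perm (Fin d)) (a b : Fin d) (hab : a ≠ b)
    (α : ℝ) (hα : α ∈ Set.Icc (0 : ℝ) 1) :
    ∃ V : Matrix (Fin d) (Fin d) ℝ, Vᵀ * V = 1 ∧
      ∀ i j, (V i j) ^ 2
        = α * (if i = σ j then (1 : ℝ) else 0)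
          + (1 - α) * (if i = (σ * Equiv.swap a b) j then (1 : ℝ) else 0) := by
  have hc : √α ^ 2 = α := Real.sq_sqrt hα.1
  have hs : √(1 - α) ^ 2 = 1 - α := Real.sq_sqrt (sub_nonneg.2 hα.2)
  have hcs : √α ^ 2 + √(1 - α) ^ 2 = 1 := by rw [hc, hs]; ring
  refine ⟨(givensRotation a b √α √(1 - α)).submatrix σ.symm id, ?_, fun i j => ?_⟩
  · rw [Matrix.transpose_submatrix, Matrix.submatrix_mul_equiv,
      givensRotation_transpose_mul_self hab hcs, Matrix.submatrix_id_id]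
  · rw [Matrix.submatrix_apply, id, givensRotation_sq hab _ _ hcs, hc, hs]
    simp only [Equiv.symm_apply_eq, Equiv.Perm.mul_apply]
    congr
end
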